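/- arXiv:1801.03516 — 2 statements merged into one kernel-verified Lean document; each statement's English description precedes it below -/
import Mathlib

section
/- Let d ≥ 1, let M be a symmetric positive semidefinite d×d real matrix, and let X be a random vector in ℝ^d with E[‖X‖₂²] < ∞. Then the law of the pair (X, M·X) is an optimal coupling of the law of X and the law of M·X; that is, E[‖X − M·X‖₂²] equals the infimum of ∫ ‖x − y‖₂² dπ(x,y) over all couplings π of the law of X and the law of M·X. -/
open MeasureTheory ProbabilityTheory Matrix Finset
open scoped ENNReal

noncomputable section

/-- A coupling of `μ` and `ν`: a probability measure on the product with the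
prescribed marginals. -/
def IsCoupling {d : ℕ} (π : Measure ((Fin d → ℝ) × (Fin d → ℝ)))
    (μ ν : Measure (Fin d → ℝ)) : Prop :=
  IsProbabilityMeasure π ∧ π.map Prod.fst = μ ∧ π.map Prod.snd = ν

/-- Squared Euclidean distance on `ℝ^d`. -/
def sqDist {d : ℕ} (x y : Fin d → ℝ) : ℝ := ∑ i, (x i - y i) ^ 2

/-- The squared 2-Wasserstein distance: infimum of the quadratic transport cost
over all couplings. -/
def W2sq {d : ℕ} (μ ν : Measure (Fin d → ℝ)) : ℝ≥0∞ :=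
  ⨅ (π : Measure ((Fin d → ℝ) × (Fin d → ℝ))) (_ : IsCoupling π μ ν),
    ∫⁻ p, ENNReal.ofReal (sqDist p.1 p.2) ∂π

/-- Quantile (generalized inverse cdf) of a measure on `ℝ`. -/
def quantile (μ : Measure ℝ) (t : ℝ) : ℝ := sInf {s : ℝ | t ≤ cdf μ s}


/-- Every real square matrix has a generalized inverse. -/
theorem exists_mul_mul_eq_self {d : ℕ} (M : Matrix (Fin d) (Fin d) ℝ) :
    ∃ N : Matrix (Fin d) (Fin d) ℝ, M * N * M = M := by
  obtain ⟨g, hg⟩ := (Matrix.toLin' M).rangeRestrict.exists_rightInverse_of_surjective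
    (LinearMap.range_rangeRestrict _)
  obtain ⟨h, hh⟩ := LinearMap.exists_extend g
  refine ⟨LinearMap.toMatrix' h, Matrix.toLin'.injective ?_⟩
  rw [Matrix.toLin'_mul, Matrix.toLin'_mul, Matrix.toLin'_toMatrix']
  refine LinearMap.ext fun x => ?_
  have h1 : h (Matrix.toLin' M x) = g ((Matrix.toLin' M).rangeRestrict x) :=
    LinearMap.congr_fun hh ((Matrix.toLin' M).rangeRestrict x)
  have h2 := congrArg Subtype.val
    (LinearMap.congr_fun hg ((Matrix.toLin' M).rangeRestrict x))
  simp only [LinearMap.comp_apply]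
  rw [h1]
  exact h2

/-- The quadratic form of a positive semidefinite matrix dominates its bilinear form. -/
theorem two_mul_dotProduct_mulVec_le {d : ℕ} {M : Matrix (Fin d) (Fin d) ℝ}
    (hM : M.PosSemidef) (x z : Fin d → ℝ) :
    2 * (x ⬝ᵥ (M *ᵥ z)) ≤ x ⬝ᵥ (M *ᵥ x) + z ⬝ᵥ (M *ᵥ z) := by
  have h := hM.dotProduct_mulVec_nonneg (x - z)
  have hs : z ⬝ᵥ (M *ᵥ x) = x ⬝ᵥ (M *ᵥ z) := by
    have hT : Mᵀ = M := by simpa using hM.isHermitian.eq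
    rw [dotProduct_mulVec, ← mulVec_transpose, hT, dotProduct_comm]
  simp only [star_trivial, mulVec_sub, dotProduct_sub, sub_dotProduct] at h
  linarith

theorem sqDist_eq_dotProduct {d : ℕ} (x y : Fin d → ℝ) :
    sqDist x y = x ⬝ᵥ x + y ⬝ᵥ y - 2 * (x ⬝ᵥ y) := by
  simp only [sqDist, dotProduct, Finset.mul_sum, ← Finset.sum_add_distrib,
    ← Finset.sum_sub_distrib]
  exact Finset.sum_congr rfl fun i _ => by ring

theorem sqDist_nonneg {d : ℕ} (x y : Fin d → ℝ) : 0 ≤ sqDist x y :=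
  Finset.sum_nonneg fun _ _ => sq_nonneg _

theorem memLp_two_mulVec {d : ℕ} {α : Type*} [MeasurableSpace α] {μ : Measure α}
    {U : α → Fin d → ℝ} (hU : ∀ i, MemLp (fun a => U a i) 2 μ)
    (A : Matrix (Fin d) (Fin d) ℝ) (i : Fin d) :
    MemLp (fun a => (A *ᵥ U a) i) 2 μ := by
  simp only [mulVec, dotProduct]
  exact memLp_finsetSum _ fun j _ => (hU j).const_mul _

theorem integrable_dotProduct {d : ℕ} {α : Type*} [MeasurableSpace α] {μ : Measure α}
    {U V : α → Fin d → ℝ} (hU : ∀ i, MemLp (fun a => U a i) 2 μ)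
    (hV : ∀ i, MemLp (fun a => V a i) 2 μ) : Integrable (fun a => U a ⬝ᵥ V a) μ := by
  simp only [dotProduct]
  exact integrable_finsetSum _ fun i _ => (hU i).integrable_mul (hV i)

theorem integrable_sqDist {d : ℕ} {α : Type*} [MeasurableSpace α] {μ : Measure α}
    {U V : α → Fin d → ℝ} (hU : ∀ i, MemLp (fun a => U a i) 2 μ)
    (hV : ∀ i, MemLp (fun a => V a i) 2 μ) :
    Integrable (fun a => sqDist (U a) (V a)) μ := by
  simp only [sqDist_eq_dotProduct]
  exact ((integrable_dotProduct hU hU).add (integrable_dotProduct hV hV)).sub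
    ((integrable_dotProduct hU hV).const_mul 2)

theorem psd_matrix_optimal_coupling
    {d : ℕ} (hd : 1 ≤ d)
    {Ω : Type*} [MeasureSpace Ω] [IsProbabilityMeasure (ℙ : Measure Ω)]
    (M : Matrix (Fin d) (Fin d) ℝ) (hM : M.PosSemidef)
    (X : Ω → Fin d → ℝ) (hXmeas : Measurable X)
    (hX2 : Integrable (fun ω => ∑ i, X ω i ^ 2) ℙ) :
    IsCoupling (Measure.map (fun ω => (X ω, M *ᵥ X ω)) ℙ)
      (Measure.map X ℙ) (Measure.map (fun ω => M *ᵥ X ω) ℙ) ∧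
    (∫⁻ p, ENNReal.ofReal (sqDist p.1 p.2)
        ∂(Measure.map (fun ω => (X ω, M *ᵥ X ω)) ℙ)) =
      W2sq (Measure.map X ℙ) (Measure.map (fun ω => M *ᵥ X ω) ℙ) := by
  have hmulVec (A : Matrix (Fin d) (Fin d) ℝ) : Continuous fun x : Fin d → ℝ => A *ᵥ x :=
    continuous_const.matrix_mulVec continuous_id
  have hMX : Measurable fun ω => M *ᵥ X ω := (hmulVec M).measurable.comp hXmeas
  have hpair : Measurable fun ω => (X ω, M *ᵥ X ω) := hXmeas.prodMk hMX
  have hcoupling : IsCoupling (Measure.map (fun ω => (X ω, M *ᵥ X ω)) ℙ)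
      (Measure.map X ℙ) (Measure.map (fun ω => M *ᵥ X ω) ℙ) :=
    ⟨Measure.isProbabilityMeasure_map hpair.aemeasurable,
      Measure.map_map measurable_fst hpair, Measure.map_map measurable_snd hpair⟩
  refine ⟨hcoupling, le_antisymm (le_iInf₂ fun π hπ => ?_) (iInf₂_le (Measure.map (fun ω => (X ω, M *ᵥ X ω)) ℙ) hcoupling)⟩
  obtain ⟨-, hfst, hsnd⟩ := hπ
  have hX (i : Fin d) : MemLp (fun ω => X ω i) 2 ℙ := by
    have hm : Measurable fun ω => X ω i := (measurable_pi_apply i).comp hXmeas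
    rw [memLp_two_iff_integrable_sq hm.aestronglyMeasurable]
    refine hX2.mono' (hm.pow_const 2).aestronglyMeasurable (.of_forall fun ω => ?_)
    rw [Real.norm_of_nonneg (sq_nonneg _)]
    exact Finset.single_le_sum (f := fun j => X ω j ^ 2) (fun j _ => sq_nonneg _)
      (Finset.mem_univ i)
  have hY := memLp_two_mulVec hX M
  have hcoord (i : Fin d) {ρ : Measure (Fin d → ℝ)} :
      AEStronglyMeasurable (fun x : Fin d → ℝ => x i) ρ :=
    (measurable_pi_apply i).aestronglyMeasurable
  have hπ₁ (i : Fin d) : MemLp (fun p : (Fin d → ℝ) × (Fin d → ℝ) => p.1 i) 2 π := by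
    have h : MemLp (fun x : Fin d → ℝ => x i) 2 (π.map Prod.fst) := by
      rw [hfst]
      exact (memLp_map_measure_iff (hcoord i) hXmeas.aemeasurable).2 (hX i)
    exact (memLp_map_measure_iff (hcoord i) measurable_fst.aemeasurable).1 h
  have hπ₂ (i : Fin d) : MemLp (fun p : (Fin d → ℝ) × (Fin d → ℝ) => p.2 i) 2 π := by
    have h : MemLp (fun x : Fin d → ℝ => x i) 2 (π.map Prod.snd) := by
      rw [hsnd]
      exact (memLp_map_measure_iff (hcoord i) hMX.aemeasurable).2 (hY i)
    exact (memLp_map_measure_iff (hcoord i) measurable_snd.aemeasurable).1 h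
  obtain ⟨N, hN⟩ := exists_mul_mul_eq_self M
  have hMN (x : Fin d → ℝ) : M *ᵥ (N *ᵥ (M *ᵥ x)) = M *ᵥ x := by
    rw [mulVec_mulVec, mulVec_mulVec, hN]
  -- Kantorovich potentials built from the quadratic form of `M`
  let a : (Fin d → ℝ) → ℝ := fun x => x ⬝ᵥ x - x ⬝ᵥ (M *ᵥ x)
  let b : (Fin d → ℝ) → ℝ := fun y => y ⬝ᵥ y - (N *ᵥ y) ⬝ᵥ (M *ᵥ (N *ᵥ y))
  have ha : Continuous a := (continuous_id.dotProduct continuous_id).sub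
    (continuous_id.dotProduct (hmulVec M))
  have hb : Continuous b := (continuous_id.dotProduct continuous_id).sub
    ((hmulVec N).dotProduct ((hmulVec M).comp (hmulVec N)))
  have haX : Integrable (fun ω => a (X ω)) ℙ :=
    (integrable_dotProduct hX hX).sub (integrable_dotProduct hX hY)
  have hbY : Integrable (fun ω => b (M *ᵥ X ω)) ℙ :=
    (integrable_dotProduct hY hY).sub (integrable_dotProduct (memLp_two_mulVec hY N)
      (memLp_two_mulVec (memLp_two_mulVec hY N) M))
  have ha₁ : Integrable (fun p : (Fin d → ℝ) × (Fin d → ℝ) => a p.1) π :=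
    (integrable_dotProduct hπ₁ hπ₁).sub
      (integrable_dotProduct hπ₁ (memLp_two_mulVec hπ₁ M))
  have hb₂ : Integrable (fun p : (Fin d → ℝ) × (Fin d → ℝ) => b p.2) π :=
    (integrable_dotProduct hπ₂ hπ₂).sub (integrable_dotProduct (memLp_two_mulVec hπ₂ N)
      (memLp_two_mulVec (memLp_two_mulVec hπ₂ N) M))
  have hsupp : ∀ᵐ p ∂π, M *ᵥ (N *ᵥ p.2) = p.2 := by
    have hset : MeasurableSet {y : Fin d → ℝ | M *ᵥ (N *ᵥ y) = y} :=
      (isClosed_eq ((hmulVec M).comp (hmulVec N)) continuous_id).measurableSet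
    have h : ∀ᵐ y ∂(π.map Prod.snd), M *ᵥ (N *ᵥ y) = y := by
      rw [hsnd]
      exact (ae_map_iff hMX.aemeasurable hset).2 (.of_forall fun ω => hMN (X ω))
    exact (ae_map_iff measurable_snd.aemeasurable hset).1 h
  have heq (x : Fin d → ℝ) : sqDist x (M *ᵥ x) = a x + b (M *ᵥ x) := by
    have h1 : (N *ᵥ (M *ᵥ x)) ⬝ᵥ (M *ᵥ x) = x ⬝ᵥ (M *ᵥ x) := by
      have hT : Mᵀ = M := by simpa using hM.isHermitian.eq
      rw [dotProduct_mulVec, ← mulVec_transpose, hT, hMN, dotProduct_comm]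
    simp only [a, b, hMN, sqDist_eq_dotProduct, h1]
    ring
  have hle : ∀ᵐ p ∂π, a p.1 + b p.2 ≤ sqDist p.1 p.2 := by
    filter_upwards [hsupp] with p hp
    have h := two_mul_dotProduct_mulVec_le hM p.1 (N *ᵥ p.2)
    rw [hp] at h
    simp only [a, b, hp, sqDist_eq_dotProduct]
    linarith
  have hmeas : Measurable fun p : (Fin d → ℝ) × (Fin d → ℝ) =>
      ENNReal.ofReal (sqDist p.1 p.2) := by
    unfold sqDist
    fun_prop
  rw [lintegral_map hmeas hpair,
    ← ofReal_integral_eq_lintegral_ofReal (integrable_sqDist hX hY)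
      (.of_forall fun _ => sqDist_nonneg _ _),
    ← ofReal_integral_eq_lintegral_ofReal (integrable_sqDist hπ₁ hπ₂)
      (.of_forall fun _ => sqDist_nonneg _ _)]
  refine ENNReal.ofReal_le_ofReal ?_
  calc ∫ ω, sqDist (X ω) (M *ᵥ X ω) ∂ℙ
      = ∫ ω, a (X ω) ∂ℙ + ∫ ω, b (M *ᵥ X ω) ∂ℙ := by
        simp only [heq]
        exact integral_add haX hbY
    _ = ∫ p, a p.1 ∂π + ∫ p, b p.2 ∂π := by
        rw [← integral_map hXmeas.aemeasurable ha.aestronglyMeasurable,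
          ← integral_map hMX.aemeasurable hb.aestronglyMeasurable, ← hfst, ← hsnd,
          integral_map measurable_fst.aemeasurable ha.aestronglyMeasurable,
          integral_map measurable_snd.aemeasurable hb.aestronglyMeasurable]
    _ = ∫ p, (a p.1 + b p.2) ∂π := (integral_add ha₁ hb₂).symm
    _ ≤ ∫ p, sqDist p.1 p.2 ∂π :=
        integral_mono_ae (ha₁.add hb₂) (integrable_sqDist hπ₁ hπ₂) hle
end
end

section
/- Let d ≥ 1 and let φ : ℝ^d → ℝ^d be continuously differentiable, monotone in the sense that ⟨x − y, φ(x) − φ(y)⟩ ≥ 0 for all x, y ∈ ℝ^d, and such that the Jacobian matrix Dφ(x) = (∂φᵢ/∂xⱼ)(x) is symmetric for every x. Let X be a random vector in ℝ^d with E[‖X‖₂²] < ∞ and E[‖φ(X)‖₂²] < ∞. Then the law of the pair (X, φ(X)) is an optimal coupling of the law of X and the law of φ(X) with respect to the 2-Wasserstein distance. -/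
open MeasureTheory ProbabilityTheory Matrix Finset
open scoped ENNReal

noncomputable section

/-- A continuously differentiable vector field with symmetric Jacobian is a gradient. -/
theorem exists_hasFDerivAt_sum_smul_proj {d : ℕ} {φ : (Fin d → ℝ) → Fin d → ℝ}
    (hφ : Differentiable ℝ φ)
    (hsymm : ∀ (x : Fin d → ℝ) (i j : Fin d),
      fderiv ℝ φ x (Pi.single j 1) i = fderiv ℝ φ x (Pi.single i 1) j) :
    ∃ f : (Fin d → ℝ) → ℝ, ∀ x, HasFDerivAt f
      (∑ i, φ x i • ContinuousLinearMap.proj (R := ℝ) (φ := fun _ : Fin d => ℝ) i) x := by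
  have hω : ∀ x, HasFDerivAt
      (fun x => ∑ i, φ x i • ContinuousLinearMap.proj (R := ℝ) (φ := fun _ : Fin d => ℝ) i)
      (∑ i, (((ContinuousLinearMap.proj (R := ℝ) (φ := fun _ : Fin d => ℝ) i).comp
        (fderiv ℝ φ x)).smulRight
          (ContinuousLinearMap.proj (R := ℝ) (φ := fun _ : Fin d => ℝ) i))) x := fun x =>
    HasFDerivAt.fun_sum fun i _ =>
      (hasFDerivAt_pi'.1 (hφ x).hasFDerivAt i).smul_const
        (ContinuousLinearMap.proj (R := ℝ) (φ := fun _ : Fin d => ℝ) i)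
  obtain ⟨f, hf⟩ := (convex_univ (𝕜 := ℝ)).exists_forall_hasFDerivAt_of_fderiv_symmetric
    isOpen_univ (fun x _ => (hω x).differentiableAt.differentiableWithinAt)
    (fun x _ u v => by
      have expand : ∀ w i, fderiv ℝ φ x w i = ∑ j, w j * fderiv ℝ φ x (Pi.single j 1) i := by
        intro w i
        conv_lhs => rw [pi_eq_sum_univ' w]
        simp [map_sum, Finset.sum_apply]
      rw [(hω x).fderiv]
      simp only [_root_.sum_apply, ContinuousLinearMap.smulRight_apply,
        ContinuousLinearMap.comp_apply, _root_.smul_apply,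
        ContinuousLinearMap.proj_apply, smul_eq_mul]
      simp only [expand u, expand v, Finset.sum_mul]
      rw [Finset.sum_comm]
      refine Finset.sum_congr rfl fun i _ => Finset.sum_congr rfl fun j _ => ?_
      rw [hsymm x j i]
      ring)
  exact ⟨f, fun x => hf x (Set.mem_univ x)⟩

/-- The first-order convexity inequality for a potential with monotone gradient. -/
theorem add_dotProduct_sub_le_of_monotone_gradient {d : ℕ} {φ : (Fin d → ℝ) → Fin d → ℝ}
    (hmono : ∀ x y : Fin d → ℝ, 0 ≤ ∑ i, (x i - y i) * (φ x i - φ y i))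
    {f : (Fin d → ℝ) → ℝ}
    (hf : ∀ x, HasFDerivAt f
      (∑ i, φ x i • ContinuousLinearMap.proj (R := ℝ) (φ := fun _ : Fin d => ℝ) i) x)
    (x y : Fin d → ℝ) :
    f x + φ x ⬝ᵥ (y - x) ≤ f y := by
  have hline : ∀ t : ℝ, HasDerivAt (fun t : ℝ => f (x + t • (y - x)))
      (φ (x + t • (y - x)) ⬝ᵥ (y - x)) t := by
    intro t
    have h1 : HasDerivAt (fun t : ℝ => x + t • (y - x)) (y - x) t := by
      simpa using ((hasDerivAt_id t).smul_const (y - x)).const_add x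
    refine ((hf (x + t • (y - x))).comp_hasDerivAt t h1).congr_deriv ?_
    simp [dotProduct]
  obtain ⟨c, ⟨hc, -⟩, hslope⟩ := exists_hasDerivAt_eq_slope
    (fun t : ℝ => f (x + t • (y - x))) _ one_pos
    (fun t _ => (hline t).continuousAt.continuousWithinAt) (fun t _ => hline t)
  have hm := hmono (x + c • (y - x)) x
  have hm' : 0 ≤ c * ((φ (x + c • (y - x)) - φ x) ⬝ᵥ (y - x)) := by
    convert hm using 1
    rw [dotProduct, Finset.mul_sum]
    refine Finset.sum_congr rfl fun i _ => ?_
    simp only [Pi.add_apply, Pi.sub_apply, Pi.smul_apply, smul_eq_mul]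
    ring
  have hnonneg := nonneg_of_mul_nonneg_right hm' hc
  rw [sub_dotProduct] at hnonneg
  simp only [one_smul, add_sub_cancel, zero_smul, add_zero, sub_zero, div_one] at hslope
  linarith

/-- A measurable version of the Legendre conjugate of a continuous function `f` on `ℝ^d`
(with the junk value of `⨆` where the conjugate is infinite). -/
def denseConjugate {d : ℕ} (f : (Fin d → ℝ) → ℝ) (y : Fin d → ℝ) : ℝ :=
  ⨆ n : ℕ, TopologicalSpace.denseSeq (Fin d → ℝ) n ⬝ᵥ y -
    f (TopologicalSpace.denseSeq (Fin d → ℝ) n)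

theorem measurable_dotProduct_right {d : ℕ} (x : Fin d → ℝ) :
    Measurable fun y : Fin d → ℝ => x ⬝ᵥ y := by
  unfold dotProduct
  fun_prop

theorem measurable_denseConjugate {d : ℕ} (f : (Fin d → ℝ) → ℝ) :
    Measurable (denseConjugate f) :=
  Measurable.iSup fun _ => (measurable_dotProduct_right _).sub_const _

/-- The Fenchel–Young inequality at points where the conjugate is finite. -/
theorem dotProduct_le_add_denseConjugate {d : ℕ} {f : (Fin d → ℝ) → ℝ} (hf : Continuous f)
    {y : Fin d → ℝ}
    (hy : BddAbove (Set.range fun n : ℕ => TopologicalSpace.denseSeq (Fin d → ℝ) n ⬝ᵥ y -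
      f (TopologicalSpace.denseSeq (Fin d → ℝ) n))) (x : Fin d → ℝ) :
    x ⬝ᵥ y ≤ f x + denseConjugate f y := by
  have hclosed : IsClosed {x : Fin d → ℝ | x ⬝ᵥ y ≤ f x + denseConjugate f y} :=
    isClosed_le (by unfold dotProduct; fun_prop) (by fun_prop)
  refine hclosed.closure_subset_iff.2 ?_ (TopologicalSpace.denseRange_denseSeq (Fin d → ℝ) x)
  rintro _ ⟨n, rfl⟩
  have := le_ciSup hy n
  simp only [Set.mem_ofPred_eq, denseConjugate]
  linarith

/-- Weak Kantorovich duality: a coupling on which a pair of integrable dual potentials is tight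
costs no more than any other coupling on which the pair is admissible. -/
theorem lintegral_sqDist_le_of_dual {d : ℕ} {μ ν : Measure (Fin d → ℝ)}
    {π π' : Measure ((Fin d → ℝ) × (Fin d → ℝ))}
    (hπ : IsCoupling π μ ν) (hπ' : IsCoupling π' μ ν) {A B : (Fin d → ℝ) → ℝ}
    (hA : Integrable A μ) (hB : Integrable B ν)
    (htight : ∀ᵐ p ∂π, A p.1 + B p.2 = sqDist p.1 p.2)
    (hle : ∀ᵐ p ∂π', A p.1 + B p.2 ≤ sqDist p.1 p.2) :
    ∫⁻ p, ENNReal.ofReal (sqDist p.1 p.2) ∂π ≤ ∫⁻ p, ENNReal.ofReal (sqDist p.1 p.2) ∂π' := by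
  have key : ∀ {ρ : Measure ((Fin d → ℝ) × (Fin d → ℝ))}, IsCoupling ρ μ ν →
      Integrable (fun p => A p.1 + B p.2) ρ ∧
        ∫ p, (A p.1 + B p.2) ∂ρ = ∫ x, A x ∂μ + ∫ y, B y ∂ν := by
    rintro ρ ⟨-, rfl, rfl⟩
    have hA' : Integrable (fun p => A p.1) ρ := hA.comp_measurable measurable_fst
    have hB' : Integrable (fun p => B p.2) ρ := hB.comp_measurable measurable_snd
    refine ⟨hA'.add hB', ?_⟩
    rw [integral_add hA' hB', integral_map measurable_fst.aemeasurable hA.1,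
      integral_map measurable_snd.aemeasurable hB.1]
  obtain ⟨hi, he⟩ := key hπ
  obtain ⟨hi', he'⟩ := key hπ'
  calc ∫⁻ p, ENNReal.ofReal (sqDist p.1 p.2) ∂π
      = ∫⁻ p, ENNReal.ofReal (A p.1 + B p.2) ∂π :=
        lintegral_congr_ae (htight.mono fun p hp => by simp only [hp])
    _ = ENNReal.ofReal (∫ p, (A p.1 + B p.2) ∂π) := by
        refine (ofReal_integral_eq_lintegral_ofReal hi (htight.mono fun p hp => ?_)).symm
        simp only [hp, sqDist, Pi.zero_apply]
        positivity
    _ = ENNReal.ofReal (∫ p, (A p.1 + B p.2) ∂π') := by rw [he, he']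
    _ ≤ ENNReal.ofReal (∫ p, max (A p.1 + B p.2) 0 ∂π') :=
        ENNReal.ofReal_le_ofReal (integral_mono hi' hi'.pos_part fun p => le_max_left _ _)
    _ = ∫⁻ p, ENNReal.ofReal (max (A p.1 + B p.2) 0) ∂π' :=
        ofReal_integral_eq_lintegral_ofReal hi'.pos_part (.of_forall fun p => le_max_right _ _)
    _ ≤ ∫⁻ p, ENNReal.ofReal (sqDist p.1 p.2) ∂π' := by
        refine lintegral_mono_ae (hle.mono fun p hp => ENNReal.ofReal_le_ofReal ?_)
        refine max_le hp ?_
        unfold sqDist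
        positivity

theorem memLp_two_apply_of_integrable_sum_sq {d : ℕ} {Ω : Type*} [MeasurableSpace Ω]
    {P : Measure Ω} {Y : Ω → Fin d → ℝ} (hY : Measurable Y)
    (hY2 : Integrable (fun ω => ∑ i, Y ω i ^ 2) P) (i : Fin d) :
    MemLp (fun ω => Y ω i) 2 P := by
  have hm : Measurable fun ω => Y ω i := by fun_prop
  refine (memLp_two_iff_integrable_sq hm.aestronglyMeasurable).2
    (hY2.mono' (hm.pow_const 2).aestronglyMeasurable (.of_forall fun ω => ?_))
  rw [Real.norm_of_nonneg (sq_nonneg _)]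
  exact Finset.single_le_sum (f := fun i => Y ω i ^ 2) (fun _ _ => sq_nonneg _)
    (Finset.mem_univ i)

theorem sqDist_eq {d : ℕ} (x y : Fin d → ℝ) :
    sqDist x y = ∑ i, x i ^ 2 + ∑ i, y i ^ 2 - 2 * (x ⬝ᵥ y) := by
  rw [sqDist, dotProduct, Finset.mul_sum, ← Finset.sum_add_distrib, ← Finset.sum_sub_distrib]
  exact Finset.sum_congr rfl fun i _ => by ring

theorem monotone_symmetric_gradient_optimal_coupling
    {d : ℕ} (hd : 1 ≤ d)
    {Ω : Type*} [MeasureSpace Ω] [IsProbabilityMeasure (ℙ : Measure Ω)]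
    (φ : (Fin d → ℝ) → Fin d → ℝ)
    (hφC1 : ContDiff ℝ 1 φ)
    (hφmono : ∀ x y : Fin d → ℝ, 0 ≤ ∑ i, (x i - y i) * (φ x i - φ y i))
    (hφsymm : ∀ (x : Fin d → ℝ) (i j : Fin d),
      fderiv ℝ φ x (Pi.single j 1) i = fderiv ℝ φ x (Pi.single i 1) j)
    (X : Ω → Fin d → ℝ) (hXmeas : Measurable X)
    (hX2 : Integrable (fun ω => ∑ i, X ω i ^ 2) ℙ)
    (hφX2 : Integrable (fun ω => ∑ i, φ (X ω) i ^ 2) ℙ) :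
    IsCoupling (Measure.map (fun ω => (X ω, φ (X ω))) ℙ)
      (Measure.map X ℙ) (Measure.map (fun ω => φ (X ω)) ℙ) ∧
    (∫⁻ p, ENNReal.ofReal (sqDist p.1 p.2)
        ∂(Measure.map (fun ω => (X ω, φ (X ω))) ℙ)) =
      W2sq (Measure.map X ℙ) (Measure.map (fun ω => φ (X ω)) ℙ) := by
  obtain ⟨f, hf⟩ := exists_hasFDerivAt_sum_smul_proj (hφC1.differentiable (by simp)) hφsymm
  have hsub := add_dotProduct_sub_le_of_monotone_gradient hφmono hf
  have hfc : Continuous f := continuous_iff_continuousAt.2 fun x => (hf x).continuousAt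
  have hφXmeas : Measurable fun ω => φ (X ω) := hφC1.continuous.measurable.comp hXmeas
  have hcomp : ∀ x z, z ⬝ᵥ φ x - f z ≤ x ⬝ᵥ φ x - f x := by
    intro x z
    have := hsub x z
    rw [dotProduct_sub, dotProduct_comm _ z, dotProduct_comm _ x] at this
    linarith
  have hbdd : ∀ x, BddAbove (Set.range fun n : ℕ =>
      TopologicalSpace.denseSeq (Fin d → ℝ) n ⬝ᵥ φ x -
        f (TopologicalSpace.denseSeq (Fin d → ℝ) n)) := by
    intro x
    refine ⟨x ⬝ᵥ φ x - f x, ?_⟩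
    rintro _ ⟨n, rfl⟩
    exact hcomp x _
  have hconj : ∀ x, denseConjugate f (φ x) = x ⬝ᵥ φ x - f x := fun x =>
    le_antisymm (ciSup_le fun n => hcomp x _)
      (by linarith [dotProduct_le_add_denseConjugate hfc (hbdd x) x])
  have hXi := memLp_two_apply_of_integrable_sum_sq hXmeas hX2
  have hφXi := memLp_two_apply_of_integrable_sum_sq hφXmeas hφX2
  have hdot : Integrable (fun ω => X ω ⬝ᵥ φ (X ω)) ℙ :=
    integrable_finsetSum _ fun i _ => (hXi i).integrable_mul (hφXi i)
  have hlin : Integrable (fun ω => φ 0 ⬝ᵥ X ω) ℙ :=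
    integrable_finsetSum _ fun i _ => ((hXi i).integrable one_le_two).const_mul _
  have hfX : Integrable (fun ω => f (X ω)) ℙ := by
    refine ((hlin.abs.add hdot.abs).add (integrable_const |f 0|)).mono'
      (hfc.measurable.comp hXmeas).aestronglyMeasurable (.of_forall fun ω => ?_)
    have h1 := hsub 0 (X ω)
    have h2 := hcomp (X ω) 0
    rw [sub_zero] at h1
    rw [zero_dotProduct] at h2
    simp only [Pi.add_apply]
    rw [Real.norm_eq_abs]
    refine abs_le.2 ⟨?_, ?_⟩
    · linarith [neg_abs_le (f 0), neg_abs_le (φ 0 ⬝ᵥ X ω), abs_nonneg (X ω ⬝ᵥ φ (X ω))]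
    · linarith [le_abs_self (f 0), le_abs_self (X ω ⬝ᵥ φ (X ω)), abs_nonneg (φ 0 ⬝ᵥ X ω)]
  have hpair : Measurable fun ω => (X ω, φ (X ω)) := hXmeas.prodMk hφXmeas
  have hcoup : IsCoupling (Measure.map (fun ω => (X ω, φ (X ω))) ℙ)
      (Measure.map X ℙ) (Measure.map (fun ω => φ (X ω)) ℙ) :=
    ⟨Measure.isProbabilityMeasure_map hpair.aemeasurable,
      Measure.map_map measurable_fst hpair, Measure.map_map measurable_snd hpair⟩
  refine ⟨hcoup, le_antisymm (le_iInf₂ fun π' hπ' => ?_) (iInf₂_le (Measure.map (fun ω => (X ω, φ (X ω))) ℙ) hcoup)⟩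
  have hAmeas : Measurable fun x : Fin d → ℝ => ∑ i, x i ^ 2 - 2 * f x :=
    Measurable.sub (by fun_prop) (hfc.measurable.const_mul 2)
  have hBmeas : Measurable fun y : Fin d → ℝ => ∑ i, y i ^ 2 - 2 * denseConjugate f y :=
    Measurable.sub (by fun_prop) ((measurable_denseConjugate f).const_mul 2)
  refine lintegral_sqDist_le_of_dual hcoup hπ'
    (A := fun x => ∑ i, x i ^ 2 - 2 * f x) (B := fun y => ∑ i, y i ^ 2 - 2 * denseConjugate f y)
    ?_ ?_ ?_ ?_
  · rw [integrable_map_measure hAmeas.aestronglyMeasurable hXmeas.aemeasurable]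
    exact hX2.sub (hfX.const_mul 2)
  · rw [integrable_map_measure hBmeas.aestronglyMeasurable hφXmeas.aemeasurable]
    have : Integrable (fun ω => denseConjugate f (φ (X ω))) ℙ := by
      simp only [hconj]
      exact hdot.sub hfX
    exact hφX2.sub (this.const_mul 2)
  · have hset : MeasurableSet {p : (Fin d → ℝ) × (Fin d → ℝ) |
        ∑ i, p.1 i ^ 2 - 2 * f p.1 + (∑ i, p.2 i ^ 2 - 2 * denseConjugate f p.2) =
          sqDist p.1 p.2} :=
      measurableSet_eq_fun ((hAmeas.comp measurable_fst).add (hBmeas.comp measurable_snd))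
        (by unfold sqDist; fun_prop)
    refine (ae_map_iff hpair.aemeasurable hset).2 (.of_forall fun ω => ?_)
    simp only [hconj, sqDist_eq]
    ring
  · have hset : MeasurableSet {y : Fin d → ℝ | BddAbove (Set.range fun n : ℕ =>
        TopologicalSpace.denseSeq (Fin d → ℝ) n ⬝ᵥ y -
          f (TopologicalSpace.denseSeq (Fin d → ℝ) n))} :=
      measurableSet_bddAbove_range fun _ => (measurable_dotProduct_right _).sub_const _
    have hν := (ae_map_iff hφXmeas.aemeasurable hset).2
      (.of_forall (f := ae (ℙ : Measure Ω)) fun ω => hbdd (X ω))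
    rw [← hπ'.2.2] at hν
    refine (ae_of_ae_map measurable_snd.aemeasurable hν).mono fun p hp => ?_
    have := dotProduct_le_add_denseConjugate hfc hp p.1
    rw [sqDist_eq]
    linarith
end
end
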